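/- Let σ > 0, Δ ≥ 0, μ₂ = Δ/σ, p ∈ [0,1], α ∈ (0,1), and let c ∈ ℝ satisfy Φ(c) = 1 − α, where Φ is the standard normal CDF. Let P = N(0, σ²) and let Q_p = (1 − p)·N(0, σ²) + p·N(Δ, σ²) be the corresponding mixture measure on ℝ. Then inf{Q_p(Eᶜ) : E ⊆ ℝ measurable, P(E) ≤ α} = (1 − p)(1 − α) + p·Φ(c − μ₂). (Single-step trade-off function of the Poisson-subsampled Gaussian mechanism for the add-one dominating pair.) -/

import Mathlib

open MeasureTheory Set ProbabilityTheory NNReal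

/-- The standard normal cumulative distribution function. -/
noncomputable def Phi (x : ℝ) : ℝ := (gaussianReal 0 1 (Iic x)).toReal

lemma aux_pdf (v : ℝ≥0) (hv : v ≠ 0) (Δ x : ℝ) :
    gaussianPDFReal Δ v x = Real.exp ((2 * x * Δ - Δ ^ 2) / (2 * v)) * gaussianPDFReal 0 v x := by
  have hv' : (v : ℝ) ≠ 0 := by exact_mod_cast hv
  simp only [gaussianPDFReal]
  rw [mul_left_comm, ← Real.exp_add]
  congr 2
  field_simp
  ring

lemma aux_real (v : ℝ≥0) (hv : v ≠ 0) (m : ℝ) (S : Set ℝ) :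
    (gaussianReal m v).real S = ∫ x in S, gaussianPDFReal m v x := by
  rw [Measure.real, gaussianReal_apply_eq_integral m hv, ENNReal.toReal_ofReal]
  exact integral_nonneg fun x => gaussianPDFReal_nonneg m v x

lemma aux_le (v : ℝ≥0) (hv : v ≠ 0) (Δ : ℝ) (hΔ : 0 ≤ Δ) (t : ℝ) (S : Set ℝ)
    (hS : MeasurableSet S) (h : S ⊆ Iic t) :
    (gaussianReal Δ v).real S ≤
      Real.exp ((2 * t * Δ - Δ ^ 2) / (2 * v)) * (gaussianReal 0 v).real S := by
  rw [aux_real v hv, aux_real v hv, ← integral_const_mul]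
  refine setIntegral_mono_on (integrable_gaussianPDFReal Δ v).integrableOn
    ((integrable_gaussianPDFReal 0 v).integrableOn.const_mul _) hS fun x hx => ?_
  rw [aux_pdf v hv]
  have := gaussianPDFReal_nonneg 0 v x
  have hx' : x ≤ t := h hx
  gcongr

lemma aux_ge (v : ℝ≥0) (hv : v ≠ 0) (Δ : ℝ) (hΔ : 0 ≤ Δ) (t : ℝ) (S : Set ℝ)
    (hS : MeasurableSet S) (h : S ⊆ Ioi t) :
    Real.exp ((2 * t * Δ - Δ ^ 2) / (2 * v)) * (gaussianReal 0 v).real S ≤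
      (gaussianReal Δ v).real S := by
  rw [aux_real v hv, aux_real v hv, ← integral_const_mul]
  refine setIntegral_mono_on ((integrable_gaussianPDFReal 0 v).integrableOn.const_mul _)
    (integrable_gaussianPDFReal Δ v).integrableOn hS fun x hx => ?_
  rw [aux_pdf v hv Δ]
  have := gaussianPDFReal_nonneg 0 v x
  have hx' : t ≤ x := le_of_lt (h hx)
  gcongr

lemma aux_np (v : ℝ≥0) (hv : v ≠ 0) (Δ : ℝ) (hΔ : 0 ≤ Δ) (t : ℝ) (F : Set ℝ)
    (hF : MeasurableSet F) (h : (gaussianReal 0 v).real (Iic t) ≤ (gaussianReal 0 v).real F) :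
    (gaussianReal Δ v).real (Iic t) ≤ (gaussianReal Δ v).real F := by
  have hB : MeasurableSet (Iic t) := measurableSet_Iic
  have h1 := aux_le v hv Δ hΔ t (Iic t \ F) (hB.diff hF) sdiff_subset
  have h2 := aux_ge v hv Δ hΔ t (F \ Iic t) (hF.diff hB) (fun x hx => by simpa using hx.2)
  have e1 := measureReal_inter_add_sdiff (μ := gaussianReal 0 v) (s := F) hB
  have e2 := measureReal_inter_add_sdiff (μ := gaussianReal 0 v) (s := (Iic t)) hF
  have e3 := measureReal_inter_add_sdiff (μ := gaussianReal Δ v) (s := F) hB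
  have e4 := measureReal_inter_add_sdiff (μ := gaussianReal Δ v) (s := (Iic t)) hF
  rw [inter_comm] at e2 e4
  have h3 : (gaussianReal 0 v).real (Iic t \ F) ≤ (gaussianReal 0 v).real (F \ Iic t) := by
    linarith
  have h4 := mul_le_mul_of_nonneg_left h3 (Real.exp_pos ((2 * t * Δ - Δ ^ 2) / (2 * v))).le
  linarith

lemma aux_Phi (σ : ℝ≥0) (hσ : 0 < σ) (m c : ℝ) :
    (gaussianReal m (σ ^ 2)).real (Iic (σ * c)) = Phi (c - m / σ) := by
  have hs : (0 : ℝ) < σ := by exact_mod_cast hσ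
  have e : gaussianReal m (σ ^ 2) =
      ((gaussianReal 0 1).map (fun x => (σ : ℝ) * x)).map (fun x => x + m) := by
    rw [gaussianReal_map_const_mul, gaussianReal_map_add_const]
    congr 1
    · simp
    · ext; simp
  rw [e, Measure.map_map (by fun_prop) (by fun_prop), Measure.real,
    Measure.map_apply (by fun_prop) measurableSet_Iic, Phi]
  congr 2
  ext x
  simp only [mem_preimage, Function.comp, mem_Iic]
  rw [le_sub_iff_add_le, ← mul_le_mul_iff_right₀ hs (b := x + m / σ)]
  have : (σ : ℝ) * (x + m / σ) = σ * x + m := by field_simp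
  rw [this]

/-- Single-step trade-off function of the Poisson-subsampled Gaussian mechanism
for the add-one dominating pair `(N(0,σ²), (1-p)N(0,σ²) + pN(Δ,σ²))`:
`T(P, Q_p)(α) = (1-p)(1-α) + pΦ(c - μ₂)`, where `Φ(c) = 1 - α`. -/
theorem tradeOff_subsampled_gaussian (σ : ℝ≥0) (hσ : 0 < σ) (Δ : ℝ) (hΔ : 0 ≤ Δ)
    (μ₂ : ℝ) (hμ₂ : μ₂ = Δ / (σ : ℝ)) (p : ℝ) (hp : p ∈ Icc (0 : ℝ) 1)
    (α : ℝ) (hα : α ∈ Ioo (0 : ℝ) 1) (c : ℝ) (hc : Phi c = 1 - α)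
    (P Q : Measure ℝ)
    (hP : P = gaussianReal 0 (σ ^ 2))
    (hQ : Q = ENNReal.ofReal (1 - p) • gaussianReal 0 (σ ^ 2) +
        ENNReal.ofReal p • gaussianReal Δ (σ ^ 2)) :
    sInf {x : ℝ | ∃ E : Set ℝ, MeasurableSet E ∧ (P E).toReal ≤ α ∧
        x = (Q Eᶜ).toReal} = (1 - p) * (1 - α) + p * Phi (c - μ₂) := by
  obtain ⟨hp0, hp1⟩ := hp
  have hv : σ ^ 2 ≠ 0 := pow_ne_zero _ hσ.ne'
  have hQr : ∀ S : Set ℝ, (Q S).toReal = (1 - p) * (gaussianReal 0 (σ ^ 2)).real S +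
      p * (gaussianReal Δ (σ ^ 2)).real S := by
    intro S
    rw [hQ, Measure.add_apply, Measure.smul_apply, Measure.smul_apply, smul_eq_mul, smul_eq_mul,
      ENNReal.toReal_add (ENNReal.mul_ne_top ENNReal.ofReal_ne_top (measure_ne_top _ _))
        (ENNReal.mul_ne_top ENNReal.ofReal_ne_top (measure_ne_top _ _)),
      ENNReal.toReal_mul, ENNReal.toReal_mul, ENNReal.toReal_ofReal (by linarith),
      ENNReal.toReal_ofReal hp0]
    rfl
  have hG : (gaussianReal 0 (σ ^ 2)).real (Iic (σ * c)) = 1 - α := by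
    rw [aux_Phi σ hσ, zero_div, sub_zero, hc]
  have hH : (gaussianReal Δ (σ ^ 2)).real (Iic (σ * c)) = Phi (c - μ₂) := by
    rw [aux_Phi σ hσ, hμ₂]
  refine IsLeast.csInf_eq ⟨⟨Ioi (σ * c), measurableSet_Ioi, ?_, ?_⟩, ?_⟩
  · rw [hP, ← compl_Iic]
    change (gaussianReal 0 (σ ^ 2)).real _ ≤ α
    rw [probReal_compl_eq_one_sub measurableSet_Iic, hG]
    linarith
  · rw [hQr, compl_Ioi, hG, hH]
  · rintro x ⟨E, hE, hEα, rfl⟩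
    have hF : 1 - α ≤ (gaussianReal 0 (σ ^ 2)).real Eᶜ := by
      rw [probReal_compl_eq_one_sub hE]
      rw [hP] at hEα
      change (gaussianReal 0 (σ ^ 2)).real _ ≤ α at hEα
      linarith
    have hN := aux_np (σ ^ 2) hv Δ hΔ (σ * c) Eᶜ hE.compl (by rw [hG]; exact hF)
    rw [hH] at hN
    rw [hQr]
    have : 0 ≤ 1 - p := by linarith
    gcongr
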